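/- Let S₁, …, S_k (k ≥ 2) be an independent family of subspaces of a real normed vector space V, and let (x_t)_{t ∈ ι} be a finite labeled data family with labels ℓ : ι → {1,…,k} such that for every class j, S_j equals the span of {x_t : ℓ(t) = j} (the in-sample data are noise-free and sufficient). Fix an index i and let y ∈ S_i with y ≠ 0. Then: (a) there exists a coefficient vector c : ι → ℝ with y = ∑_{t ∈ ι} c_t · x_t; and (b) for every such c, the residuals r_j = ‖y − ∑_{t : ℓ(t) = j} c_t · x_t‖ satisfy r_i = 0 and r_j = ‖y‖ > 0 for all j ≠ i, so the minimal-residual assignment rule assigns y to class i and to no other class. -/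

import Mathlib

/-- Independent subspaces of a real normed vector space, labeled data family
with `S j = span {x t : ℓ t = j}` for every class `j` (noise-free and
sufficient data). For any `y ∈ S i` with `y ≠ 0`:
(a) there is a coefficient vector `c` with `y = ∑ t, c t • x t`; and
(b) for every such `c`, the residuals satisfy `r i = 0` and `r j = ‖y‖ > 0`
for all `j ≠ i`, so `y` is assigned to class `i` and to no other class. -/
theorem stmt_7 {V : Type*} [NormedAddCommGroup V] [NormedSpace ℝ V]
    {k : ℕ} (hk : 2 ≤ k) (S : Fin k → Submodule ℝ V)
    (hind : ∀ i : Fin k, S i ⊓ (⨆ j : Fin k, ⨆ _ : j ≠ i, S j) = ⊥)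
    {ι : Type*} [Fintype ι] (x : ι → V) (ℓ : ι → Fin k)
    (hspan : ∀ j : Fin k, S j = Submodule.span ℝ (x '' {t | ℓ t = j}))
    (i : Fin k) (y : V) (hy : y ∈ S i) (hy0 : y ≠ 0) :
    (∃ c : ι → ℝ, y = ∑ t, c t • x t) ∧
    (∀ c : ι → ℝ, y = ∑ t, c t • x t →
      ‖y - ∑ t ∈ Finset.univ.filter (fun t => ℓ t = i), c t • x t‖ = 0 ∧
      ∀ j : Fin k, j ≠ i →
        ‖y - ∑ t ∈ Finset.univ.filter (fun t => ℓ t = j), c t • x t‖ = ‖y‖ ∧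
        0 < ‖y - ∑ t ∈ Finset.univ.filter (fun t => ℓ t = j), c t • x t‖) := by
  constructor
  · have h : y ∈ Submodule.span ℝ (Set.range x) := by
      rw [hspan i] at hy
      exact Submodule.span_mono (Set.image_subset_range _ _) hy
    obtain ⟨c, hc⟩ := (Submodule.mem_span_range_iff_exists_fun ℝ).1 h
    exact ⟨c, hc.symm⟩
  · intro c hc
    have hP : ∀ j, ∑ t ∈ Finset.univ.filter (fun t => ℓ t = j), c t • x t ∈ S j := by
      intro j
      refine Submodule.sum_mem _ fun t ht => Submodule.smul_mem _ _ ?_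
      rw [hspan j]
      exact Submodule.subset_span ⟨t, (Finset.mem_filter.1 ht).2, rfl⟩
    have hsum : ∑ j, ∑ t ∈ Finset.univ.filter (fun t => ℓ t = j), c t • x t = y := by
      rw [hc]
      exact Finset.sum_fiberwise _ _ _
    generalize hPP : (fun j => ∑ t ∈ Finset.univ.filter (fun t => ℓ t = j), c t • x t) = P
    have hPj : ∀ j, ∑ t ∈ Finset.univ.filter (fun t => ℓ t = j), c t • x t = P j :=
      fun j => congrFun hPP j
    simp only [hPj] at hP hsum ⊢
    have hd : ∀ j, P j - (if j = i then y else 0) ∈ S j := by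
      intro j
      refine Submodule.sub_mem _ (hP j) ?_
      split_ifs with h
      · exact h ▸ hy
      · exact Submodule.zero_mem _
    have hds : ∑ j, (P j - (if j = i then y else 0)) = 0 := by
      simp [Finset.sum_sub_distrib, hsum]
    have hz : ∀ j, P j - (if j = i then y else 0) = 0 := by
      intro j
      rw [← Submodule.mem_bot ℝ, ← hind j]
      refine ⟨hd j, ?_⟩
      rw [← Finset.add_sum_erase _ _ (Finset.mem_univ j)] at hds
      rw [eq_neg_of_add_eq_zero_left hds]
      refine Submodule.neg_mem _ (Submodule.sum_mem _ fun m hm => ?_)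
      exact Submodule.mem_iSup_of_mem m
        (Submodule.mem_iSup_of_mem (Finset.ne_of_mem_erase hm) (hd m))
    refine ⟨?_, fun j hj => ?_⟩
    · have := hz i
      rw [if_pos rfl, sub_eq_zero] at this
      simp [this]
    · have := hz j
      rw [if_neg hj, sub_zero] at this
      simp [this, hy0]
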